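/- For all u, v, t ∈ ℝ, the parallelogram P = (u, v, t) is a rectangle if and only if v² = u² + (μ − λ)·t². Thus in the coordinates (u, v, t) the set of rectangles in Π is the quadric defined by v² = u² + (μ − λ)·t². -/

import Mathlib

noncomputable section

open Real Set

/-- Membership predicate for conformally inscribed parallelograms.
Coordinates of `P : Fin 9 → ℝ`:
`0 = x_A, 1 = y_A, 2 = x_B, 3 = y_B, 4 = x_C, 5 = y_C, 6 = x_D, 7 = y_D, 8 = w`.
The vertex `(x_L, y_L)` lies on the line `L(w)` for `L ∈ {A,B,C,D}` and the
midpoints of the two diagonals coincide. -/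
def IsCIP (mA mB mC mD bA : ℝ) (P : Fin 9 → ℝ) : Prop :=
  P 1 = mA * P 0 + bA * P 8 ∧
  P 3 = mB * P 2 + P 8 ∧
  P 5 = mC * P 4 ∧
  P 7 = mD * P 6 ∧
  P 0 + P 4 = P 2 + P 6 ∧
  P 1 + P 5 = P 3 + P 7

/-- `Π`, the set of conformally inscribed parallelograms. -/
def CIP (mA mB mC mD bA : ℝ) : Set (Fin 9 → ℝ) := {P | IsCIP mA mB mC mD bA P}

/-- The `AC` diagonal vector of a parallelogram. -/
def vAC (P : Fin 9 → ℝ) : ℝ × ℝ := (P 0 - P 4, P 1 - P 5)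

/-- The `BD` diagonal vector of a parallelogram. -/
def vBD (P : Fin 9 → ℝ) : ℝ × ℝ := (P 2 - P 6, P 3 - P 7)

/-- The `AB` side vector of a parallelogram. -/
def vAB (P : Fin 9 → ℝ) : ℝ × ℝ := (P 0 - P 2, P 1 - P 3)

/-- The `BC` side vector of a parallelogram. -/
def vBC (P : Fin 9 → ℝ) : ℝ × ℝ := (P 2 - P 4, P 3 - P 5)

/-- Dot product in `ℝ²`. -/
def dot2 (a b : ℝ × ℝ) : ℝ := a.1 * b.1 + a.2 * b.2

/-- The inner product `⟨P, Q⟩ = P_AC · Q_AC + P_BD · Q_BD` on `Π`. -/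
def pinner (P Q : Fin 9 → ℝ) : ℝ := dot2 (vAC P) (vAC Q) + dot2 (vBD P) (vBD Q)

theorem vAC_add (P Q : Fin 9 → ℝ) : vAC (P + Q) = vAC P + vAC Q := by
  ext <;> simp only [vAC, Pi.add_apply, Prod.mk_add_mk] <;> ring

theorem vAC_smul (c : ℝ) (P : Fin 9 → ℝ) : vAC (c • P) = c • vAC P := by
  ext <;> simp only [vAC, Pi.smul_apply, Prod.smul_mk, smul_eq_mul] <;> ring

theorem vBD_add (P Q : Fin 9 → ℝ) : vBD (P + Q) = vBD P + vBD Q := by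
  ext <;> simp only [vBD, Pi.add_apply, Prod.mk_add_mk] <;> ring

theorem vBD_smul (c : ℝ) (P : Fin 9 → ℝ) : vBD (c • P) = c • vBD P := by
  ext <;> simp only [vBD, Pi.smul_apply, Prod.smul_mk, smul_eq_mul] <;> ring

theorem dot2_smul_add_smul_self (r s : ℝ) (a b : ℝ × ℝ) :
    dot2 (r • a + s • b) (r • a + s • b) =
      r ^ 2 * dot2 a a + 2 * r * s * dot2 a b + s ^ 2 * dot2 b b := by
  simp only [dot2, Prod.fst_add, Prod.snd_add, Prod.smul_fst, Prod.smul_snd, smul_eq_mul]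
  ring

theorem dot2_zero_left (a : ℝ × ℝ) : dot2 (0, 0) a = 0 := by
  simp [dot2]

theorem stmt_9 (mA mB mC mD bA : ℝ) (hCD : mC ≠ mD)
    (U V T : Fin 9 → ℝ)
    (hU : U ∈ CIP mA mB mC mD bA) (hV : V ∈ CIP mA mB mC mD bA)
    (hT : T ∈ CIP mA mB mC mD bA)
    (hUU : pinner U U = 1) (hVV : pinner V V = 1) (hTT : pinner T T = 1)
    (hUV : pinner U V = 0) (hUT : pinner U T = 0) (hVT : pinner V T = 0)
    (hspan : ∀ P ∈ CIP mA mB mC mD bA, ∃ u v t : ℝ, P = u • U + v • V + t • T)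
    (hUAC : vAC U = (0, 0)) (hVBD : vBD V = (0, 0))
    (lam mu : ℝ) (hlam : lam = dot2 (vAC T) (vAC T)) (hmu : mu = dot2 (vBD T) (vBD T)) :
    ∀ (u v t : ℝ) (P : Fin 9 → ℝ), P = u • U + v • V + t • T →
      (dot2 (vAC P) (vAC P) = dot2 (vBD P) (vBD P) ↔
        v ^ 2 = u ^ 2 + (mu - lam) * t ^ 2) := by
  rintro u v t P rfl
  simp only [pinner, hUAC, hVBD, dot2_zero_left, zero_add, add_zero] at hUU hVV hUT hVT
  have hAC : vAC (u • U + v • V + t • T) = v • vAC V + t • vAC T := by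
    simp [vAC_add, vAC_smul, hUAC]
  have hBD : vBD (u • U + v • V + t • T) = u • vBD U + t • vBD T := by
    simp [vBD_add, vBD_smul, hVBD]
  rw [hAC, hBD, dot2_smul_add_smul_self, dot2_smul_add_smul_self, hUU, hVV, hUT, hVT,
    ← hlam, ← hmu]
  constructor <;> intro h <;> linear_combination h
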